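/- Let (ρ_i) ⊂ F_M^r be a minimizing sequence of H_C^r. Then there exist δ₀ > 0, R₀ > 0, i₀ ∈ ℕ, and a sequence of shift vectors (a_i) ⊂ ℝ³ such that ∫_{a_i+B_R} ρ_i(x) dx ≥ δ₀ for all i ≥ i₀ and all R ≥ R₀, where a_i + B_R is the closed ball of radius R centered at a_i. -/

import Mathlib

open MeasureTheory Real Filter Topology

noncomputable section

abbrev Space : Type := EuclideanSpace ℝ (Fin 3)

/-- Induced gravitational potential `U_ρ = -ρ ∗ 1/|·|`. -/
def Upot (ρ : Space → ℝ) : Space → ℝ := fun x => - ∫ y : Space, ρ y / ‖x - y‖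

/-- Induced gravitational field `∇U_ρ`. -/
def gradU (ρ : Space → ℝ) : Space → Space := fun x => gradient (Upot ρ) x

/-- Potential energy. -/
def Epot (ρ : Space → ℝ) : ℝ :=
  -(1/2) * ∫ x : Space, ∫ y : Space, ρ x * ρ y / ‖x - y‖

/-- The reduced energy-Casimir functional `H_C^r(ρ) = ∫ Φ(ρ) + E_pot(ρ)`. -/
def HCr (Φ : ℝ → ℝ) (ρ : Space → ℝ) : ℝ := (∫ x : Space, Φ (ρ x)) + Epot ρ

/-- The reduced constraint set `F_M^r = {ρ ∈ L¹₊ : ∫ Φ(ρ) < ∞, ∫ ρ = M}`. -/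
def FMr (Φ : ℝ → ℝ) (M : ℝ) : Set (Space → ℝ) :=
  {ρ | (∀ x, 0 ≤ ρ x) ∧ Integrable ρ ∧
       Integrable (fun x => Φ (ρ x)) ∧ (∫ x : Space, ρ x) = M}

/-- The infimum `h_M^r` of `H_C^r` over `F_M^r`. -/
def hMr (Φ : ℝ → ℝ) (M : ℝ) : ℝ := sInf (HCr Φ '' FMr Φ M)

/-- Assumptions on `Φ`: `Φ ∈ C¹([0,∞))` with derivative `Φ'`, `Φ(0) = Φ'(0) = 0`,
strictly convex, `Φ(r) ≥ C r^{1+1/n}` for large `r` with `0 < n < 3`, and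
`Φ(r) ≤ C r^{1+1/n'}` for small `r` with `0 < n' < 3`. -/
structure PhiHyp (Φ Φ' : ℝ → ℝ) (n n' : ℝ) : Prop where
  n_pos : 0 < n
  n_lt_three : n < 3
  n'_pos : 0 < n'
  n'_lt_three : n' < 3
  hasDeriv : ∀ r ∈ Set.Ici (0:ℝ), HasDerivWithinAt Φ (Φ' r) (Set.Ici 0) r
  contDeriv : ContinuousOn Φ' (Set.Ici 0)
  zero : Φ 0 = 0
  derivZero : Φ' 0 = 0
  strictConvex : StrictConvexOn ℝ (Set.Ici 0) Φ
  growth : ∃ C > (0:ℝ), ∃ r₁ : ℝ, ∀ r : ℝ, r₁ ≤ r → C * r ^ (1 + 1/n) ≤ Φ r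
  small : ∃ C > (0:ℝ), ∃ r₁ > (0:ℝ), ∀ r : ℝ, 0 ≤ r → r ≤ r₁ → Φ r ≤ C * r ^ (1 + 1/n')

/-- The Newtonian kernel is integrable near the origin. -/
lemma integrableOn_inv_norm_ball (r : ℝ) :
    IntegrableOn (fun y : Space => ‖y‖⁻¹) (Metric.ball 0 r) := by
  rw [integrableOn_fun_norm_addHaar volume (f := fun t : ℝ => t⁻¹)]
  have h : IntegrableOn (fun y : ℝ => y) (Set.Ioo 0 r) :=
    (continuous_id.integrableOn_Icc (a := 0) (b := r)).mono_set Set.Ioo_subset_Icc_self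
  refine h.congr_fun (fun y hy => ?_) measurableSet_Ioo
  have : y ≠ 0 := hy.1.ne'
  simp only [finrank_euclideanSpace, Fintype.card_fin, smul_eq_mul]
  norm_num
  field_simp

lemma setIntegral_inv_norm_ball {r : ℝ} (hr : 0 < r) :
    ∫ y in Metric.ball (0 : Space) r, ‖y‖⁻¹ =
      (∫ y in Metric.ball (0 : Space) 1, ‖y‖⁻¹) * r ^ 2 := by
  have h := Measure.setIntegral_comp_smul_of_pos (volume : Measure Space)
    (fun y : Space => ‖y‖⁻¹) (Metric.ball 0 1) hr
  rw [smul_unitBall hr.ne', Real.norm_of_nonneg hr.le] at h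
  simp only [norm_smul, Real.norm_of_nonneg hr.le, mul_inv, smul_eq_mul, integral_const_mul,
    finrank_euclideanSpace, Fintype.card_fin] at h
  field_simp at h
  simp only [one_div] at h
  rw [← h, mul_comm]

/-- The self-similar bound on the potential of a ball at its centre. -/
lemma exists_setLIntegral_inv_enorm_ball_le :
    ∃ c : ℝ, 0 < c ∧ ∀ (x : Space) (r : ℝ), 0 < r →
      ∫⁻ y in Metric.ball x r, ‖x - y‖ₑ⁻¹ ≤ ENNReal.ofReal (c * r ^ 2) := by
  set I := ∫ y in Metric.ball (0 : Space) 1, ‖y‖⁻¹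
  have hI : 0 ≤ I := integral_nonneg fun _ => by positivity
  refine ⟨I + 1, by positivity, fun x r hr => ?_⟩
  have h1 : ∫⁻ y in Metric.ball x r, ‖x - y‖ₑ⁻¹ = ∫⁻ y in Metric.ball (0 : Space) r, ‖y‖ₑ⁻¹ := by
    rw [← lintegral_indicator Metric.isOpen_ball.measurableSet,
      ← lintegral_indicator Metric.isOpen_ball.measurableSet,
      ← lintegral_sub_left_eq_self _ x]
    refine lintegral_congr fun y => ?_
    simp [Set.indicator, dist_eq_norm]
  have h2 : ∫⁻ y in Metric.ball (0 : Space) r, ‖y‖ₑ⁻¹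
      = ∫⁻ y in Metric.ball (0 : Space) r, ENNReal.ofReal (‖y‖⁻¹) := by
    refine lintegral_congr_ae (ae_restrict_of_ae ?_)
    filter_upwards [compl_mem_ae_iff.mpr (measure_singleton (0 : Space))] with y hy
    have hy : 0 < ‖y‖ := norm_pos_iff.mpr hy
    rw [ENNReal.ofReal_inv_of_pos hy, ofReal_norm]
  rw [h1, h2, ← ofReal_integral_eq_lintegral_ofReal (integrableOn_inv_norm_ball r)
    (Eventually.of_forall fun _ => by positivity), setIntegral_inv_norm_ball hr]
  gcongr
  linarith

/-- The potential generated by the part of a density lying below the level `t` is controlled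
by `δ ^ (2/3) * t ^ (1/3)`, where `δ` bounds the mass in balls of radius `R`,
up to the contribution `M / R` of the far field. -/
lemma lintegral_truncated_potential_le {c : ℝ} (hc : 0 < c)
    (hball : ∀ (x : Space) (r : ℝ), 0 < r →
      ∫⁻ y in Metric.ball x r, ‖x - y‖ₑ⁻¹ ≤ ENNReal.ofReal (c * r ^ 2))
    {f : Space → ℝ} (hf : Measurable f) {M δ R t : ℝ} (hM : 0 ≤ M) (hδ : 0 < δ) (hR : 0 < R)
    (ht : 0 < t) (hmass : ∫⁻ y, ENNReal.ofReal (f y) ≤ ENNReal.ofReal M)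
    (hloc : ∀ a, ∫⁻ y in Metric.closedBall a R, ENNReal.ofReal (f y) ≤ ENNReal.ofReal δ)
    (x : Space) :
    ∫⁻ y, (if f y ≤ t then ENNReal.ofReal (f y) * ‖x - y‖ₑ⁻¹ else 0) ≤
      ENNReal.ofReal ((c + 1) * δ ^ (2 / 3 : ℝ) * t ^ (1 / 3 : ℝ) + M / R) := by
  set r : ℝ := δ ^ (1 / 3 : ℝ) * t ^ (-(1 / 3) : ℝ) with hr_def
  have hr : 0 < r := by positivity
  have hpt : ∀ y, (if f y ≤ t then ENNReal.ofReal (f y) * ‖x - y‖ₑ⁻¹ else 0) ≤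
      (Metric.ball x r).indicator (fun y => ENNReal.ofReal t * ‖x - y‖ₑ⁻¹) y +
      (Metric.closedBall x R).indicator
        (fun y => ENNReal.ofReal r⁻¹ * ENNReal.ofReal (f y)) y +
      ENNReal.ofReal R⁻¹ * ENNReal.ofReal (f y) := by
    intro y
    have far : ∀ s : ℝ, 0 < s → s ≤ dist y x → ‖x - y‖ₑ⁻¹ ≤ ENNReal.ofReal s⁻¹ := by
      intro s hs hsy
      rw [ENNReal.ofReal_inv_of_pos hs, ENNReal.inv_le_inv, ← ofReal_norm, ← dist_eq_norm,
        dist_comm]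
      exact ENNReal.ofReal_le_ofReal hsy
    split_ifs with hy
    · by_cases h1 : dist y x < r
      · rw [Set.indicator_of_mem (Metric.mem_ball.mpr h1), add_assoc]
        refine le_add_right ?_
        gcongr
      · by_cases h2 : dist y x ≤ R
        · rw [Set.indicator_of_mem (Metric.mem_closedBall.mpr h2)]
          refine le_add_right (le_add_left ?_)
          rw [mul_comm]
          gcongr
          exact far r hr (not_lt.mp h1)
        · refine le_add_left ?_
          rw [mul_comm]
          gcongr
          exact far R hR (not_le.mp h2).le
    · exact zero_le
  refine (lintegral_mono hpt).trans ?_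
  rw [lintegral_add_right _ (by fun_prop), lintegral_add_right _
      (Measurable.indicator (by fun_prop) Metric.isClosed_closedBall.measurableSet),
    lintegral_indicator Metric.isOpen_ball.measurableSet,
    lintegral_indicator Metric.isClosed_closedBall.measurableSet,
    lintegral_const_mul' _ _ ENNReal.ofReal_ne_top, lintegral_const_mul' _ _ ENNReal.ofReal_ne_top,
    lintegral_const_mul' _ _ ENNReal.ofReal_ne_top]
  calc _ ≤ ENNReal.ofReal t * ENNReal.ofReal (c * r ^ 2)
        + ENNReal.ofReal r⁻¹ * ENNReal.ofReal δ + ENNReal.ofReal R⁻¹ * ENNReal.ofReal M := by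
        gcongr
        · exact hball x r hr
        · exact hloc x
    _ = ENNReal.ofReal (t * (c * r ^ 2) + r⁻¹ * δ + R⁻¹ * M) := by
        rw [← ENNReal.ofReal_mul (by positivity), ← ENNReal.ofReal_mul (by positivity),
          ← ENNReal.ofReal_mul (by positivity), ← ENNReal.ofReal_add (by positivity)
          (by positivity), ← ENNReal.ofReal_add (by positivity) (by positivity)]
    _ = _ := by
        congr 1
        have e1 : r⁻¹ * δ = δ ^ (2 / 3 : ℝ) * t ^ (1 / 3 : ℝ) := by
          have h1 : δ = δ ^ (1 / 3 : ℝ) * δ ^ (2 / 3 : ℝ) := by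
            rw [← Real.rpow_add hδ]; norm_num
          rw [hr_def, mul_inv, Real.rpow_neg ht.le, inv_inv]
          nth_rewrite 2 [h1]
          have : δ ^ (1 / 3 : ℝ) ≠ 0 := by positivity
          field_simp
        have e2 : t * r ^ 2 = δ ^ (2 / 3 : ℝ) * t ^ (1 / 3 : ℝ) := by
          rw [hr_def, mul_pow, ← Real.rpow_mul_natCast hδ.le, ← Real.rpow_mul_natCast ht.le]
          have h1 : t ^ (1 / 3 : ℝ) = t * t ^ (-(1 / 3) * (2 : ℕ) : ℝ) := by
            conv_rhs => enter [1]; rw [← Real.rpow_one t]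
            rw [← Real.rpow_add ht]; norm_num
          rw [h1]; norm_num; ring
        have e3 : t * (c * r ^ 2) = c * (t * r ^ 2) := by ring
        rw [e3, e2, e1]; ring

/-- A Hardy-Littlewood-Sobolev type bound for the Coulomb energy that keeps track of the
concentration of mass in balls of radius `R`. -/
lemma lintegral_coulomb_le {c : ℝ} (hc : 0 < c)
    (hball : ∀ (x : Space) (r : ℝ), 0 < r →
      ∫⁻ y in Metric.ball x r, ‖x - y‖ₑ⁻¹ ≤ ENNReal.ofReal (c * r ^ 2))
    {f : Space → ℝ} (hf : Measurable f) {M δ R : ℝ} (hM : 0 ≤ M) (hδ : 0 < δ) (hR : 0 < R)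
    (hmass : ∫⁻ y, ENNReal.ofReal (f y) ≤ ENNReal.ofReal M)
    (hloc : ∀ a, ∫⁻ y in Metric.closedBall a R, ENNReal.ofReal (f y) ≤ ENNReal.ofReal δ) :
    ∫⁻ x, ∫⁻ y, ENNReal.ofReal (f x) * ENNReal.ofReal (f y) * ‖x - y‖ₑ⁻¹ ≤
      2 * (ENNReal.ofReal ((c + 1) * δ ^ (2 / 3 : ℝ)) * (∫⁻ x, ENNReal.ofReal (f x ^ (4 / 3 : ℝ)))
        + ENNReal.ofReal (M ^ 2 / R)) := by
  set H : Space → Space → ENNReal := fun x y =>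
    if f y ≤ f x then ENNReal.ofReal (f x) * ENNReal.ofReal (f y) * ‖x - y‖ₑ⁻¹ else 0 with hH
  have hHm : Measurable (Function.uncurry H) := by
    refine Measurable.ite (measurableSet_le (by fun_prop) (by fun_prop)) (by fun_prop)
      measurable_const
  have hpt : ∀ x y, ENNReal.ofReal (f x) * ENNReal.ofReal (f y) * ‖x - y‖ₑ⁻¹ ≤ H x y + H y x := by
    intro x y
    rcases le_total (f y) (f x) with h | h
    · refine le_add_right ?_
      simp [hH, h]
    · refine le_add_left ?_
      simp only [hH, h, if_true]
      rw [mul_comm (ENNReal.ofReal (f x)), enorm_sub_rev]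
  have hHle : ∫⁻ x, ∫⁻ y, H x y ≤
      ENNReal.ofReal ((c + 1) * δ ^ (2 / 3 : ℝ)) * (∫⁻ x, ENNReal.ofReal (f x ^ (4 / 3 : ℝ)))
        + ENNReal.ofReal (M ^ 2 / R) := by
    calc ∫⁻ x, ∫⁻ y, H x y
        ≤ ∫⁻ x, (ENNReal.ofReal ((c + 1) * δ ^ (2 / 3 : ℝ)) * ENNReal.ofReal (f x ^ (4 / 3 : ℝ))
          + ENNReal.ofReal (M / R) * ENNReal.ofReal (f x)) := by
          refine lintegral_mono fun x => ?_
          rcases le_or_gt (f x) 0 with hx | hx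
          · have : ∀ y, H x y = 0 := fun y => by simp [hH, ENNReal.ofReal_of_nonpos hx]
            simp [this]
          · have h1 : ∀ y, H x y = ENNReal.ofReal (f x) *
                (if f y ≤ f x then ENNReal.ofReal (f y) * ‖x - y‖ₑ⁻¹ else 0) := fun y => by
              simp only [hH, mul_ite, mul_zero, mul_assoc]
            simp only [h1]
            rw [lintegral_const_mul' _ _ ENNReal.ofReal_ne_top]
            grw [lintegral_truncated_potential_le hc hball hf hM hδ hR hx hmass hloc x]
            rw [← ENNReal.ofReal_mul hx.le, ← ENNReal.ofReal_mul (by positivity),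
              ← ENNReal.ofReal_mul (by positivity), ← ENNReal.ofReal_add (by positivity)
              (by positivity)]
            apply ENNReal.ofReal_le_ofReal
            have : f x ^ (4 / 3 : ℝ) = f x * f x ^ (1 / 3 : ℝ) := by
              conv_rhs => enter [1]; rw [← Real.rpow_one (f x)]
              rw [← Real.rpow_add hx]; norm_num
            rw [this]
            apply le_of_eq
            ring
      _ = ENNReal.ofReal ((c + 1) * δ ^ (2 / 3 : ℝ)) * (∫⁻ x, ENNReal.ofReal (f x ^ (4 / 3 : ℝ)))
          + ENNReal.ofReal (M / R) * ∫⁻ x, ENNReal.ofReal (f x) := by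
          rw [lintegral_add_right _ (by fun_prop), lintegral_const_mul' _ _ ENNReal.ofReal_ne_top,
            lintegral_const_mul' _ _ ENNReal.ofReal_ne_top]
      _ ≤ _ := by
          grw [hmass]
          rw [← ENNReal.ofReal_mul (by positivity)]
          gcongr
          apply le_of_eq
          ring
  calc _ ≤ ∫⁻ x, ∫⁻ y, (H x y + H y x) :=
        lintegral_mono fun x => lintegral_mono fun y => hpt x y
    _ = (∫⁻ x, ∫⁻ y, H x y) + ∫⁻ x, ∫⁻ y, H y x := by
        rw [← lintegral_add_left hHm.lintegral_prod_right]
        refine lintegral_congr fun x => ?_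
        exact lintegral_add_left (hHm.of_uncurry_left) _
    _ = 2 * ∫⁻ x, ∫⁻ y, H x y := by
        rw [two_mul, lintegral_lintegral_swap hHm.aemeasurable]
    _ ≤ _ := by grw [hHle]

lemma setLIntegral_ofReal_eq {ρ : Space → ℝ} (h0 : ∀ x, 0 ≤ ρ x) (hρ : Integrable ρ)
    (s : Set Space) : ∫⁻ x in s, ENNReal.ofReal (ρ x) = ENNReal.ofReal (∫ x in s, ρ x) :=
  (ofReal_integral_eq_lintegral_ofReal hρ.integrableOn (Eventually.of_forall h0)).symm

lemma exists_lintegral_coulomb_le :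
    ∃ K : ℝ, 0 < K ∧ ∀ (ρ : Space → ℝ) (δ R : ℝ), (∀ x, 0 ≤ ρ x) → Integrable ρ →
      Integrable (fun x => ρ x ^ (4 / 3 : ℝ)) → 0 < δ → 0 < R →
      (∀ a, ∫ x in Metric.closedBall a R, ρ x ≤ δ) →
      ∫⁻ x, ∫⁻ y, ENNReal.ofReal (ρ x) * ENNReal.ofReal (ρ y) * ‖x - y‖ₑ⁻¹ ≤
        ENNReal.ofReal (2 * (K * δ ^ (2 / 3 : ℝ) * (∫ x, ρ x ^ (4 / 3 : ℝ)) +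
          (∫ x, ρ x) ^ 2 / R)) := by
  obtain ⟨c, hc, hball⟩ := exists_setLIntegral_inv_enorm_ball_le
  refine ⟨c + 1, by positivity, fun ρ δ R h0 hρ hρ' hδ hR hloc => ?_⟩
  set f := hρ.aestronglyMeasurable.mk ρ
  have hf : Measurable f := hρ.aestronglyMeasurable.stronglyMeasurable_mk.measurable
  have hfρ : f =ᵐ[volume] ρ := hρ.aestronglyMeasurable.ae_eq_mk.symm
  have hM : 0 ≤ ∫ x, ρ x := integral_nonneg h0
  have hI : 0 ≤ ∫ x, ρ x ^ (4 / 3 : ℝ) := integral_nonneg fun x => Real.rpow_nonneg (h0 x) _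
  have hs : ∀ s : Set Space,
      ∫⁻ y in s, ENNReal.ofReal (f y) = ENNReal.ofReal (∫ y in s, ρ y) := fun s => by
    rw [← setLIntegral_ofReal_eq h0 hρ]
    exact lintegral_congr_ae (ae_restrict_of_ae (hfρ.fun_comp ENNReal.ofReal))
  have key := lintegral_coulomb_le hc hball hf hM hδ hR
    (by simpa only [Measure.restrict_univ] using (hs Set.univ).le)
    (fun a => (hs _).trans_le (ENNReal.ofReal_le_ofReal (hloc a)))
  have e1 : ∫⁻ x, ENNReal.ofReal (f x ^ (4 / 3 : ℝ)) =
      ENNReal.ofReal (∫ x, ρ x ^ (4 / 3 : ℝ)) := by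
    rw [ofReal_integral_eq_lintegral_ofReal hρ'
      (Eventually.of_forall fun x => Real.rpow_nonneg (h0 x) _)]
    exact lintegral_congr_ae (hfρ.fun_comp fun t => ENNReal.ofReal (t ^ (4 / 3 : ℝ)))
  have e2 : ∫⁻ x, ∫⁻ y, ENNReal.ofReal (f x) * ENNReal.ofReal (f y) * ‖x - y‖ₑ⁻¹ =
      ∫⁻ x, ∫⁻ y, ENNReal.ofReal (ρ x) * ENNReal.ofReal (ρ y) * ‖x - y‖ₑ⁻¹ := by
    refine lintegral_congr_ae ?_
    filter_upwards [hfρ] with x hx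
    refine lintegral_congr_ae ?_
    filter_upwards [hfρ] with y hy
    rw [hx, hy]
  rw [e1, e2] at key
  refine key.trans (le_of_eq ?_)
  rw [← ENNReal.ofReal_mul (by positivity), ← ENNReal.ofReal_add (by positivity) (by positivity),
    ENNReal.ofReal_mul (by norm_num)]
  simp

lemma enorm_coulomb_le {ρ : Space → ℝ} (h0 : ∀ x, 0 ≤ ρ x) (x y : Space) :
    ‖ρ x * ρ y / ‖x - y‖‖ₑ ≤ ENNReal.ofReal (ρ x) * ENNReal.ofReal (ρ y) * ‖x - y‖ₑ⁻¹ := by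
  have hxy := mul_nonneg (h0 x) (h0 y)
  rcases (norm_nonneg (x - y)).eq_or_lt with h | h
  · simp [← h]
  · rw [Real.enorm_of_nonneg (by positivity), div_eq_mul_inv, ENNReal.ofReal_mul hxy,
      ENNReal.ofReal_mul (h0 x), ENNReal.ofReal_inv_of_pos h, ofReal_norm]

/-- The potential energy is bounded by the concentration of mass. -/
lemma exists_neg_Epot_le :
    ∃ K : ℝ, 0 < K ∧ ∀ (ρ : Space → ℝ) (δ R : ℝ), (∀ x, 0 ≤ ρ x) → Integrable ρ →
      Integrable (fun x => ρ x ^ (4 / 3 : ℝ)) → 0 < δ → 0 < R →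
      (∀ a, ∫ x in Metric.closedBall a R, ρ x ≤ δ) →
      -Epot ρ ≤ K * δ ^ (2 / 3 : ℝ) * (∫ x, ρ x ^ (4 / 3 : ℝ)) + (∫ x, ρ x) ^ 2 / R := by
  obtain ⟨K, hK, h⟩ := exists_lintegral_coulomb_le
  refine ⟨K, hK, fun ρ δ R h0 hρ hρ' hδ hR hloc => ?_⟩
  have hI : 0 ≤ ∫ x, ρ x ^ (4 / 3 : ℝ) := integral_nonneg fun x => Real.rpow_nonneg (h0 x) _
  have h1 : ‖∫ x, ∫ y, ρ x * ρ y / ‖x - y‖‖ₑ ≤ ENNReal.ofReal _ :=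
    calc _ ≤ ∫⁻ x, ‖∫ y, ρ x * ρ y / ‖x - y‖‖ₑ := enorm_integral_le_lintegral_enorm _
      _ ≤ ∫⁻ x, ∫⁻ y, ‖ρ x * ρ y / ‖x - y‖‖ₑ :=
        lintegral_mono fun x => enorm_integral_le_lintegral_enorm _
      _ ≤ _ := lintegral_mono fun x => lintegral_mono fun y => enorm_coulomb_le h0 x y
      _ ≤ _ := h ρ δ R h0 hρ hρ' hδ hR hloc
  rw [← ofReal_norm, ENNReal.ofReal_le_ofReal_iff (by positivity)] at h1
  have h2 := (Real.le_norm_self _).trans h1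
  unfold Epot
  linarith

/-- A density concentrated in a ball of radius `L` has potential energy at most
`-M ^ 2 / (4 * L)`. -/
lemma Epot_le_of_support {ρ : Space → ℝ} (hm : Measurable ρ) (h0 : ∀ x, 0 ≤ ρ x)
    (hρ : Integrable ρ) (hρ' : Integrable (fun x => ρ x ^ (4 / 3 : ℝ))) {L : ℝ} (hL : 0 < L)
    (hsupp : ∀ x, L < ‖x‖ → ρ x = 0) : Epot ρ ≤ -((∫ x, ρ x) ^ 2 / (4 * L)) := by
  obtain ⟨K, hK, h⟩ := exists_lintegral_coulomb_le
  have hM : 0 ≤ ∫ x, ρ x := integral_nonneg h0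
  have hfin := h ρ ((∫ x, ρ x) + 1) 1 h0 hρ hρ' (by positivity) one_pos fun a =>
    (setIntegral_le_integral hρ (Eventually.of_forall h0)).trans (by linarith)
  have hInt : Integrable (fun p : Space × Space => ρ p.1 * ρ p.2 / ‖p.1 - p.2‖)
      (volume.prod volume) := by
    have hmeas : Measurable (fun p : Space × Space => ρ p.1 * ρ p.2 / ‖p.1 - p.2‖) := by fun_prop
    refine ⟨hmeas.aestronglyMeasurable, ?_⟩
    rw [HasFiniteIntegral, lintegral_prod _ (by fun_prop)]
    refine lt_of_le_of_lt ?_ (hfin.trans_lt ENNReal.ofReal_lt_top)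
    exact lintegral_mono fun x => lintegral_mono fun y => enorm_coulomb_le h0 x y
  have hpt : ∀ x y : Space, x ≠ y → ρ x * ρ y / (2 * L) ≤ ρ x * ρ y / ‖x - y‖ := by
    intro x y hxy
    have hpos : 0 < ‖x - y‖ := norm_pos_iff.mpr (sub_ne_zero.mpr hxy)
    rcases lt_or_ge L ‖x‖ with hx | hx
    · simp [hsupp x hx]
    rcases lt_or_ge L ‖y‖ with hy | hy
    · simp [hsupp y hy]
    have := norm_sub_le x y
    have := mul_nonneg (h0 x) (h0 y)
    gcongr
    linarith
  have hineq : (∫ x, ρ x) ^ 2 / (2 * L) ≤ ∫ x, ∫ y, ρ x * ρ y / ‖x - y‖ := by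
    have e : (∫ x, ρ x) ^ 2 / (2 * L) = ∫ x, ρ x * ((∫ y, ρ y) / (2 * L)) := by
      rw [integral_mul_const]; ring
    rw [e]
    refine integral_mono_ae (hρ.mul_const _) hInt.integral_prod_left ?_
    filter_upwards [hInt.prod_right_ae] with x hx
    have e' : ρ x * ((∫ y, ρ y) / (2 * L)) = ∫ y, ρ x * ρ y / (2 * L) := by
      rw [integral_div, integral_const_mul]; ring
    rw [e']
    refine integral_mono_ae ((hρ.const_mul _).div_const _) hx ?_
    filter_upwards [compl_mem_ae_iff.mpr (measure_singleton x)] with y hy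
    exact hpt x y fun hxy => hy hxy.symm
  have e : (∫ x, ρ x) ^ 2 / (4 * L) = 1 / 2 * ((∫ x, ρ x) ^ 2 / (2 * L)) := by
    field_simp; norm_num
  unfold Epot
  rw [e]
  linarith

section PhiHyp

variable {Φ Φ' : ℝ → ℝ} {n n' : ℝ}

lemma PhiHyp.nonneg (hΦ : PhiHyp Φ Φ' n n') {r : ℝ} (hr : 0 ≤ r) : 0 ≤ Φ r := by
  rcases hr.eq_or_lt with rfl | hr
  · exact hΦ.zero.ge
  have h := hΦ.strictConvex.convexOn.le_slope_of_hasDerivWithinAt (Set.mem_Ici.mpr le_rfl)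
    (Set.mem_Ici.mpr hr.le) hr (hΦ.hasDeriv 0 (Set.mem_Ici.mpr le_rfl))
  rw [hΦ.derivZero, slope_def_field, hΦ.zero, sub_zero, sub_zero] at h
  by_contra! hneg
  exact absurd h (not_le.mpr (div_neg_of_neg_of_pos hneg hr))

lemma PhiHyp.exists_rpow_le (hΦ : PhiHyp Φ Φ' n n') {η : ℝ} (hη : 0 < η) :
    ∃ A : ℝ, 0 ≤ A ∧ ∀ r : ℝ, 0 ≤ r → r ^ (4 / 3 : ℝ) ≤ η * Φ r + A * r := by
  obtain ⟨C, hC, r₁, h⟩ := hΦ.growth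
  have he : 0 < 1 / n - 1 / 3 := by
    have := one_div_lt_one_div_of_lt hΦ.n_pos hΦ.n_lt_three
    linarith
  obtain ⟨s, hs⟩ := eventually_atTop.mp
    ((tendsto_rpow_atTop he).eventually_ge_atTop (1 / (η * C)))
  set t := max 1 (max r₁ s)
  have ht : 0 < t := one_pos.trans_le (le_max_left _ _)
  refine ⟨t ^ (1 / 3 : ℝ), by positivity, fun r hr => ?_⟩
  rcases le_or_gt t r with hr' | hr'
  · have hr0 : 0 < r := ht.trans_le hr'
    have h1 := h r ((le_max_left r₁ s).trans ((le_max_right _ _).trans hr'))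
    have h2 := hs r ((le_max_right r₁ s).trans ((le_max_right _ _).trans hr'))
    rw [div_le_iff₀ (by positivity)] at h2
    have e : r ^ (1 + 1 / n) = r ^ (4 / 3 : ℝ) * r ^ (1 / n - 1 / 3) := by
      rw [← Real.rpow_add hr0]; ring_nf
    have hp : 0 < r ^ (4 / 3 : ℝ) := by positivity
    calc r ^ (4 / 3 : ℝ) ≤ r ^ (4 / 3 : ℝ) * (r ^ (1 / n - 1 / 3) * (η * C)) :=
          le_mul_of_one_le_right hp.le h2
      _ = η * (C * r ^ (1 + 1 / n)) := by rw [e]; ring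
      _ ≤ η * Φ r := by gcongr
      _ ≤ _ := le_add_of_nonneg_right (by positivity)
  · have e : r ^ (4 / 3 : ℝ) = r ^ (1 / 3 : ℝ) * r := by
      conv_rhs => enter [2]; rw [← Real.rpow_one r]
      rw [← Real.rpow_add_of_nonneg hr (by norm_num) (by norm_num)]; norm_num
    rw [e]
    have := mul_nonneg hη.le (hΦ.nonneg hr)
    have : r ^ (1 / 3 : ℝ) * r ≤ t ^ (1 / 3 : ℝ) * r := by gcongr
    linarith

lemma PhiHyp.integrable_rpow (hΦ : PhiHyp Φ Φ' n n') {M : ℝ} {ρ : Space → ℝ}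
    (hρ : ρ ∈ FMr Φ M) : Integrable (fun x => ρ x ^ (4 / 3 : ℝ)) := by
  obtain ⟨A, -, h⟩ := hΦ.exists_rpow_le one_pos
  refine ((hρ.2.2.1.const_mul 1).add (hρ.2.1.const_mul A)).mono'
    (hρ.2.1.aestronglyMeasurable.aemeasurable.pow_const _).aestronglyMeasurable
    (Eventually.of_forall fun x => ?_)
  rw [Real.norm_of_nonneg (Real.rpow_nonneg (hρ.1 x) _)]
  exact h _ (hρ.1 x)

lemma PhiHyp.exists_integral_rpow_le (hΦ : PhiHyp Φ Φ' n n') (M : ℝ) {η : ℝ} (hη : 0 < η) :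
    ∃ A : ℝ, ∀ ρ ∈ FMr Φ M, ∫ x, ρ x ^ (4 / 3 : ℝ) ≤ η * (∫ x, Φ (ρ x)) + A := by
  obtain ⟨A, -, h⟩ := hΦ.exists_rpow_le hη
  refine ⟨A * M, fun ρ hρ => ?_⟩
  rw [← hρ.2.2.2, ← integral_const_mul, ← integral_const_mul,
    ← integral_add (hρ.2.2.1.const_mul _) (hρ.2.1.const_mul _)]
  exact integral_mono (hΦ.integrable_rpow hρ)
    ((hρ.2.2.1.const_mul _).add (hρ.2.1.const_mul _)) fun x => h _ (hρ.1 x)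

/-- Coercivity of the energy-Casimir functional. -/
lemma PhiHyp.exists_integral_le_HCr (hΦ : PhiHyp Φ Φ' n n') {M : ℝ} (hM : 0 < M) :
    ∃ B : ℝ, ∀ ρ ∈ FMr Φ M, ∫ x, Φ (ρ x) ≤ 2 * HCr Φ ρ + B := by
  obtain ⟨K, hK, hE⟩ := exists_neg_Epot_le
  set k := K * M ^ (2 / 3 : ℝ)
  have hk : 0 < k := by positivity
  obtain ⟨A, hA⟩ := hΦ.exists_integral_rpow_le M (η := 1 / (2 * k)) (by positivity)
  refine ⟨2 * (k * A + M ^ 2), fun ρ hρ => ?_⟩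
  have h1 := hE ρ M 1 hρ.1 hρ.2.1 (hΦ.integrable_rpow hρ) hM one_pos fun a =>
    (setIntegral_le_integral hρ.2.1 (Eventually.of_forall hρ.1)).trans hρ.2.2.2.le
  rw [hρ.2.2.2, div_one] at h1
  have h2 := mul_le_mul_of_nonneg_left (hA ρ hρ) hk.le
  have h3 : k * (1 / (2 * k) * (∫ x, Φ (ρ x)) + A) = 1 / 2 * (∫ x, Φ (ρ x)) + k * A := by
    field_simp
  unfold HCr
  linarith

/-- Sufficiently spread out homogeneous balls have negative energy. -/
lemma PhiHyp.exists_HCr_neg (hΦ : PhiHyp Φ Φ' n n') {M : ℝ} (hM : 0 < M) :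
    ∃ ρ ∈ FMr Φ M, HCr Φ ρ < 0 := by
  obtain ⟨C, hC, r₁, hr₁, h⟩ := hΦ.small
  set v := (volume : Measure Space).real (Metric.ball 0 1)
  have hv : 0 < v := ENNReal.toReal_pos
    (Metric.measure_ball_pos _ _ one_pos).ne' measure_ball_lt_top.ne
  have he : 0 < 1 / n' - 1 / 3 := by
    have := one_div_lt_one_div_of_lt hΦ.n'_pos hΦ.n'_lt_three
    linarith
  set b := M / 4 * (v / M) ^ (1 / 3 : ℝ)
  have hb : 0 < b := by positivity
  have hlim : Tendsto (fun c : ℝ => C * c ^ (1 / n' - 1 / 3)) (𝓝[>] 0) (𝓝 0) := by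
    have h1 : ContinuousAt (fun c : ℝ => C * c ^ (1 / n' - 1 / 3)) 0 :=
      continuousAt_const.mul (Real.continuousAt_rpow_const _ _ (Or.inr he.le))
    have h2 := h1.tendsto.mono_left (nhdsWithin_le_nhds (s := Set.Ioi 0))
    rwa [Real.zero_rpow he.ne', mul_zero] at h2
  obtain ⟨c, hcb, hc, hcr⟩ :=
    ((hlim.eventually_lt_const hb).and (Ioc_mem_nhdsGT hr₁)).exists
  set L : ℝ := (M / (v * c)) ^ (1 / 3 : ℝ) with hL_def
  have hL : 0 < L := by positivity
  have hL3 : L ^ 3 * v * c = M := by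
    rw [hL_def, ← Real.rpow_mul_natCast (by positivity)]
    norm_num
    field_simp
  have hvol : (volume : Measure Space).real (Metric.ball 0 L) = L ^ 3 * v := by
    rw [Measure.real, Measure.addHaar_ball _ _ hL.le, ENNReal.toReal_mul,
      ENNReal.toReal_ofReal (by positivity), finrank_euclideanSpace, Fintype.card_fin]
    rfl
  have hball : MeasurableSet (Metric.ball (0 : Space) L) := Metric.isOpen_ball.measurableSet
  have hcomp : ∀ g : ℝ → ℝ, g 0 = 0 →
      (fun x => g ((Metric.ball (0 : Space) L).indicator (fun _ => c) x)) =
        (Metric.ball (0 : Space) L).indicator (fun _ => g c) := fun g hg => by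
    ext x
    by_cases hx : x ∈ Metric.ball (0 : Space) L <;> simp [hx, hg]
  have hInt : ∀ d : ℝ, Integrable ((Metric.ball (0 : Space) L).indicator (fun _ => d)) := fun d =>
    (integrable_indicator_iff hball).mpr (integrableOn_const measure_ball_lt_top.ne)
  have hval : ∀ d : ℝ, ∫ x, (Metric.ball (0 : Space) L).indicator (fun _ => d) x =
      L ^ 3 * v * d := fun d => by
    rw [integral_indicator_const _ hball, hvol, smul_eq_mul]
  have hmem : (Metric.ball (0 : Space) L).indicator (fun _ => c) ∈ FMr Φ M := by
    refine ⟨fun x => Set.indicator_nonneg (fun _ _ => hc.le) x, hInt c, ?_, ?_⟩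
    · rw [hcomp Φ hΦ.zero]
      exact hInt _
    · rw [hval, hL3]
  refine ⟨_, hmem, ?_⟩
  have hE := Epot_le_of_support (measurable_const.indicator hball) hmem.1 hmem.2.1
    (hΦ.integrable_rpow hmem) hL fun x hx =>
      Set.indicator_of_notMem (fun hx' => lt_asymm hx (mem_ball_zero_iff.mp hx')) _
  rw [hmem.2.2.2] at hE
  have hP : ∫ x, Φ ((Metric.ball (0 : Space) L).indicator (fun _ => c) x) <
      M ^ 2 / (4 * L) := by
    rw [hcomp Φ hΦ.zero, hval]
    have e1 : c ^ (1 + 1 / n') = c * c ^ (1 / 3 : ℝ) * c ^ (1 / n' - 1 / 3) := by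
      conv_rhs => enter [1, 1]; rw [← Real.rpow_one c]
      rw [← Real.rpow_add hc, ← Real.rpow_add hc]; ring_nf
    have e2 : L⁻¹ = (v / M) ^ (1 / 3 : ℝ) * c ^ (1 / 3 : ℝ) := by
      rw [hL_def, ← Real.inv_rpow (by positivity), ← Real.mul_rpow (by positivity) hc.le]
      congr 1
      field_simp
    calc L ^ 3 * v * Φ c ≤ L ^ 3 * v * (C * c ^ (1 + 1 / n')) := by
          gcongr
          exact h c hc.le hcr
      _ = M * c ^ (1 / 3 : ℝ) * (C * c ^ (1 / n' - 1 / 3)) := by rw [e1, ← hL3]; ring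
      _ < M * c ^ (1 / 3 : ℝ) * b := by gcongr
      _ = M ^ 2 / 4 * L⁻¹ := by rw [e2]; ring
      _ = M ^ 2 / (4 * L) := by field_simp
  unfold HCr
  linarith

end PhiHyp

/-- No vanishing: along any minimizing sequence `(ρ_i) ⊂ F_M^r` of
`H_C^r` there are `δ₀ > 0`, `R₀ > 0`, `i₀ ∈ ℕ` and shift vectors `(a_i) ⊂ ℝ³` with
`∫_{a_i+B_R} ρ_i ≥ δ₀` for all `i ≥ i₀` and `R ≥ R₀`. -/
theorem no_vanishing (Φ Φ' : ℝ → ℝ) (n n' : ℝ) (hΦ : PhiHyp Φ Φ' n n')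
    (M : ℝ) (hM : 0 < M)
    (ρ : ℕ → Space → ℝ) (hmem : ∀ i, ρ i ∈ FMr Φ M)
    (hmin : Tendsto (fun i => HCr Φ (ρ i)) atTop (nhds (hMr Φ M))) :
    ∃ δ₀ > (0:ℝ), ∃ R₀ > (0:ℝ), ∃ i₀ : ℕ, ∃ a : ℕ → Space,
      ∀ i ≥ i₀, ∀ R ≥ R₀, δ₀ ≤ ∫ x in Metric.closedBall (a i) R, ρ i x := by
  obtain ⟨K, hK, hE⟩ := exists_neg_Epot_le
  obtain ⟨B, hB⟩ := hΦ.exists_integral_le_HCr hM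
  obtain ⟨A, hA⟩ := hΦ.exists_integral_rpow_le M one_pos
  have hΦ0 : ∀ σ ∈ FMr Φ M, 0 ≤ ∫ x, Φ (σ x) := fun σ hσ =>
    integral_nonneg fun x => hΦ.nonneg (hσ.1 x)
  have hbdd : BddBelow (HCr Φ '' FMr Φ M) := by
    refine ⟨-B / 2, ?_⟩
    rintro _ ⟨σ, hσ, rfl⟩
    linarith [hΦ0 σ hσ, hB σ hσ]
  obtain ⟨σ, hσ, hσneg⟩ := hΦ.exists_HCr_neg hM
  obtain ⟨e, he, heM⟩ : ∃ e : ℝ, 0 < e ∧ hMr Φ M = -e :=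
    ⟨-hMr Φ M, neg_pos.mpr ((csInf_le hbdd ⟨σ, hσ, rfl⟩).trans_lt hσneg), (neg_neg _).symm⟩
  obtain ⟨i₀, hi₀⟩ := eventually_atTop.mp (hmin.eventually_lt_const (u := -(e / 2)) (by linarith))
  set Q := |B + A| + 1
  have hQ : 0 < Q := by positivity
  set δ : ℝ := (e / (8 * K * Q)) ^ (3 / 2 : ℝ) with hδ_def
  have hδ : 0 < δ := by positivity
  have hδ' : K * δ ^ (2 / 3 : ℝ) * Q = e / 8 := by
    rw [hδ_def, ← Real.rpow_mul (by positivity)]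
    norm_num
    field_simp
  set R₀ := 8 * M ^ 2 / e with hR₀_def
  have hR₀ : 0 < R₀ := by positivity
  have hR₀' : M ^ 2 / R₀ = e / 8 := by
    rw [hR₀_def]; field_simp
  have key : ∀ i, ∃ a, i₀ ≤ i → δ ≤ ∫ x in Metric.closedBall a R₀, ρ i x := by
    intro i
    by_contra! hcon
    have hi := hi₀ i (hcon 0).1
    have hmi := hmem i
    have h1 := hE (ρ i) δ R₀ hmi.1 hmi.2.1 (hΦ.integrable_rpow hmi) hδ hR₀
      fun a => (hcon a).2.le
    rw [hmi.2.2.2, hR₀'] at h1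
    have h2 : ∫ x, ρ i x ^ (4 / 3 : ℝ) ≤ Q := by
      linarith [hA _ hmi, hB _ hmi, le_abs_self (B + A)]
    have h3 : K * δ ^ (2 / 3 : ℝ) * ∫ x, ρ i x ^ (4 / 3 : ℝ) ≤ e / 8 := by
      rw [← hδ']; gcongr
    have h4 := hΦ0 _ hmi
    unfold HCr at hi
    linarith
  choose a ha using key
  refine ⟨δ, hδ, R₀, hR₀, i₀, a, fun i hi R hR => (ha i hi).trans ?_⟩
  exact setIntegral_mono_set (hmem i).2.1.integrableOn (Eventually.of_forall (hmem i).1)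
    (Metric.closedBall_subset_closedBall hR).eventuallyLE
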